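/- Let f : ℂ → ℂ be an entire function with f(z) ≠ 0 for all z ∈ ℂ, and suppose that the corestriction of f, viewed as a map from ℂ onto the subspace ℂ∖{0}, is a (topological) covering map. Then there exist a, b ∈ ℂ with a ≠ 0 such that f(z) = exp(a·z + b) for all z ∈ ℂ. -/

import Mathlib

open Complex

open Filter Topology Function in
/-- A continuous lift of a differentiable function through `exp` is differentiable. -/
lemma differentiable_of_continuous_of_exp_comp {f h : ℂ → ℂ} (hf : Differentiable ℂ f)
    (hc : Continuous h) (hfh : ∀ z, exp (h z) = f z) : Differentiable ℂ h := by
  intro z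
  obtain ⟨L, hL⟩ : ∃ L : OpenPartialHomeomorph ℂ ℂ, h z ∈ L.source ∧
      (∀ x, L x = exp x) ∧ HasDerivAt L.symm (exp (h z))⁻¹ (exp (h z)) := by
    have hs : HasStrictDerivAt exp (exp (h z)) (h z) := hasStrictDerivAt_exp _
    refine ⟨(hs.hasStrictFDerivAt_equiv (exp_ne_zero _)).toOpenPartialHomeomorph exp,
      (hs.hasStrictFDerivAt_equiv (exp_ne_zero _)).mem_toOpenPartialHomeomorph_source,
      fun _ ↦ rfl, ?_⟩
    exact (hs.to_localInverse (exp_ne_zero _)).hasDerivAt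
  obtain ⟨hs, hLe, hLd⟩ := hL
  rw [hfh] at hLd
  refine (hLd.differentiableAt.comp z (hf z)).congr_of_eventuallyEq ?_
  filter_upwards [hc.continuousAt (L.open_source.mem_nhds hs)] with w hw
  simp only [comp_apply, ← hfh, ← hLe]
  exact (L.left_inv hw).symm

open Filter Topology Function in
/-- A continuous two-sided inverse of an entire function is entire. -/
lemma differentiable_inverse_of_entire {h k : ℂ → ℂ} (hd : Differentiable ℂ h)
    (hk : Continuous k) (hr : RightInverse k h) : Differentiable ℂ k := by
  intro w
  refine (analyticAt_of_differentiable_on_punctured_nhds_of_continuousAt ?_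
    hk.continuousAt).differentiableAt
  have hkw : Tendsto k (𝓝[≠] w) (𝓝[≠] (k w)) :=
    tendsto_nhdsWithin_of_tendsto_nhds_of_eventually_within _
      (hk.continuousAt.mono_left nhdsWithin_le_nhds)
      (eventually_mem_nhdsWithin.mono fun z hz ↦ hr.injective.ne hz)
  have hda : AnalyticOnNhd ℂ (deriv h) Set.univ :=
    fun z _ ↦ (hd.analyticAt z).deriv
  have hne : ∀ᶠ z in 𝓝[≠] (k w), deriv h z ≠ 0 := by
    refine (hda (k w) trivial).eventually_eq_zero_or_eventually_ne_zero.resolve_left fun h0 ↦ ?_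
    have h1 := hda.eqOn_zero_of_preconnected_of_eventuallyEq_zero isPreconnected_univ trivial h0
    have h2 := is_const_of_deriv_eq_zero hd fun z ↦ h1 (Set.mem_univ z)
    have h3 := h2 (k 0) (k 1)
    rw [hr, hr] at h3
    exact zero_ne_one h3
  filter_upwards [hkw.eventually hne] with z hz
  exact ((hd (k z)).hasDerivAt.of_local_left_inverse hk.continuousAt hz
    (.of_forall hr)).differentiableAt

open Filter Topology Function in
/-- Conjugating an entire homeomorphism fixing `0` by inversion gives an entire function. -/
lemma differentiable_inv_conj {h k : ℂ → ℂ} (hd : Differentiable ℂ h) (hk : Continuous k)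
    (hl : LeftInverse k h) (hr : RightInverse k h) (h0 : h 0 = 0) :
    Differentiable ℂ fun w ↦ (h w⁻¹)⁻¹ := by
  have hpt : ∀ w : ℂ, w ≠ 0 → DifferentiableAt ℂ (fun w ↦ (h w⁻¹)⁻¹) w := fun w hw ↦ by
    refine DifferentiableAt.inv ((hd _).comp w (differentiableAt_inv hw)) fun h1 ↦ ?_
    exact inv_ne_zero hw (hl.injective (h1.trans h0.symm))
  intro w
  rcases eq_or_ne w 0 with rfl | hw
  · refine (analyticAt_of_differentiable_on_punctured_nhds_of_continuousAt
      (eventually_mem_nhdsWithin.mono hpt) ?_).differentiableAt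
    rw [continuousAt_iff_punctured_nhds]
    have hcl : Tendsto h (Bornology.cobounded ℂ) (Bornology.cobounded ℂ) := by
      rw [Metric.cobounded_eq_cocompact]
      exact (Homeomorph.mk ⟨h, k, hl, hr⟩ hd.continuous hk).isClosedEmbedding.tendsto_cocompact
    simpa [h0, comp_def] using
      tendsto_inv₀_cobounded.comp (hcl.comp tendsto_inv₀_nhdsNE_zero)
  · exact hpt w hw

open Filter Topology Function in
/-- An entire homeomorphism of the plane fixing `0` is linear. -/
lemma entire_homeomorph_eq_mul {h k : ℂ → ℂ} (hd : Differentiable ℂ h) (hk : Continuous k)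
    (hl : LeftInverse k h) (hr : RightInverse k h) (h0 : h 0 = 0) :
    ∃ a : ℂ, a ≠ 0 ∧ ∀ z, h z = a * z := by
  have hkd := differentiable_inverse_of_entire hd hk hr
  have k0 : k 0 = 0 := by simpa [h0] using hl 0
  have hG := differentiable_inv_conj hd hk hl hr h0
  have hK := differentiable_inv_conj hkd hd.continuous hr hl k0
  set G : ℂ → ℂ := fun w ↦ (h w⁻¹)⁻¹ with hGdef
  set K : ℂ → ℂ := fun w ↦ (k w⁻¹)⁻¹ with hKdef
  have hKG : K ∘ G = id := by
    ext w
    simp [hGdef, hKdef, hl w⁻¹]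
  have hG' : deriv G 0 ≠ 0 := fun hz ↦ by
    have h1 := (hK (G 0)).hasDerivAt.comp 0 (hG 0).hasDerivAt
    rw [hKG, hz, mul_zero] at h1
    exact zero_ne_one (h1.unique (hasDerivAt_id 0))
  have hlim : Tendsto (dslope h 0) (cocompact ℂ) (𝓝 (deriv G 0)⁻¹) := by
    rw [← Metric.cobounded_eq_cocompact]
    have h1 := ((hasDerivAt_iff_tendsto_slope.1 (hG 0).hasDerivAt).comp
      tendsto_inv₀_cobounded').inv₀ hG'
    refine h1.congr' ?_
    filter_upwards [Bornology.eventually_ne_cobounded (0 : ℂ)] with z hz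
    simp [dslope_of_ne _ hz, slope_def_field, hGdef, h0, div_eq_mul_inv, mul_comm]
  have hds : Differentiable ℂ (dslope h 0) := by
    rw [← differentiableOn_univ, Complex.differentiableOn_dslope univ_mem]
    exact hd.differentiableOn
  refine ⟨(deriv G 0)⁻¹, inv_ne_zero hG', fun z ↦ ?_⟩
  have h2 := sub_smul_dslope h 0 z
  rw [hds.apply_eq_of_tendsto_cocompact z hlim] at h2
  simpa [h0, mul_comm] using h2.symm

open Function in
/-- An entire homeomorphism of the plane is affine. -/
lemma entire_homeomorph_eq_affine {h k : ℂ → ℂ} (hd : Differentiable ℂ h) (hk : Continuous k)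
    (hl : LeftInverse k h) (hr : RightInverse k h) :
    ∃ a b : ℂ, a ≠ 0 ∧ ∀ z, h z = a * z + b := by
  obtain ⟨a, ha, hz⟩ := entire_homeomorph_eq_mul (h := fun z ↦ h z - h 0)
    (k := fun w ↦ k (w + h 0)) (hd.sub_const _) (by fun_prop) (fun z ↦ by simp [hl z])
    (fun w ↦ by simp [hr (w + h 0)]) (by simp)
  exact ⟨a, h 0, ha, fun z ↦ sub_eq_iff_eq_add.1 (hz z)⟩

/-- If `f` is entire, nowhere zero, and its corestriction `ℂ → ℂ∖{0}` is a
topological covering map, then `f(z) = exp(a·z + b)` for some `a ≠ 0`. -/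
theorem entire_covering_of_punctured_plane_is_exp (f : ℂ → ℂ)
    (hdiff : Differentiable ℂ f) (hne : ∀ z, f z ≠ 0)
    (hcov : IsCoveringMap (fun z : ℂ => (⟨f z, hne z⟩ : {w : ℂ // w ≠ 0}))) :
    ∃ a b : ℂ, a ≠ 0 ∧ ∀ z, f z = Complex.exp (a * z + b) := by
  have hexp := isCoveringMap_exp
  have hw : exp (log (f 0)) = f 0 := exp_log (hne 0)
  obtain ⟨h, ⟨hh0, hh⟩, -⟩ := hexp.existsUnique_continuousMap_lifts
    ⟨_, hcov.continuous⟩ 0 (log (f 0)) (Subtype.ext hw)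
  obtain ⟨k, ⟨hk0, hk⟩, -⟩ := hcov.existsUnique_continuousMap_lifts
    ⟨_, hexp.continuous⟩ (log (f 0)) 0 (Subtype.ext hw.symm)
  have hh' : ∀ z, exp (h z) = f z := fun z ↦ congrArg Subtype.val (congrFun hh z)
  have hk' : ∀ z, f (k z) = exp z := fun z ↦ congrArg Subtype.val (congrFun hk z)
  have hl : k ∘ h = id := hcov.eq_of_comp_eq (k.continuous.comp h.continuous) continuous_id
    (funext fun z ↦ Subtype.ext (by simp [hk', hh'])) 0 (by simp [hh0, hk0])
  have hr : h ∘ k = id := hexp.eq_of_comp_eq (h.continuous.comp k.continuous) continuous_id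
    (funext fun z ↦ Subtype.ext (by simp [hk', hh'])) (log (f 0)) (by simp [hh0, hk0])
  obtain ⟨a, b, ha, hab⟩ := entire_homeomorph_eq_affine
    (differentiable_of_continuous_of_exp_comp hdiff h.continuous hh') k.continuous
    (congrFun hl) (congrFun hr)
  exact ⟨a, b, ha, fun z ↦ by rw [← hab, hh']⟩
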